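/- arXiv:1710.07123 — 4 statements merged into one kernel-verified Lean document; each statement's English description precedes it below -/
import Mathlib

section
/- (Linear characterization of the Borel sigma-algebra.) Let 𝕂 ∈ {ℝ, ℂ} and let (V,‖·‖_V) be a separable normed 𝕂-vector space. Then there exists a sequence (φ_n)_{n∈ℕ} of continuous linear functionals φ_n ∈ V' such that the Borel sigma-algebra 𝓑(V) of V equals the sigma-algebra on V generated by all continuous linear functionals φ ∈ V' (i.e. the smallest sigma-algebra making every φ ∈ V' measurable with respect to 𝓑(𝕂)), and also equals the sigma-algebra on V generated by the countable family (φ_n)_{n∈ℕ}. -/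
/-- In a separable normed space, countably many functionals of norm at most one norm the space. -/
theorem exists_seq_dual_norming (𝕜 : Type*) [RCLike 𝕜]
    (V : Type*) [NormedAddCommGroup V] [NormedSpace 𝕜 V]
    [TopologicalSpace.SeparableSpace V] :
    ∃ φ : ℕ → (V →L[𝕜] 𝕜), ∀ (x : V) (r : ℝ), ‖x‖ ≤ r ↔ ∀ n, ‖φ n x‖ ≤ r := by
  choose g hg hgx using fun x : V => exists_dual_vector'' 𝕜 x
  let d := TopologicalSpace.denseSeq V
  refine ⟨fun n => g (d n), fun x r => ⟨fun h n => ?_, fun h => ?_⟩⟩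
  · exact ((g (d n)).le_of_opNorm_le (hg _) x).trans (by simpa using h)
  · refine le_of_forall_pos_le_add fun ε hε => ?_
    obtain ⟨n, hn⟩ := (TopologicalSpace.denseRange_denseSeq V).exists_dist_lt x (half_pos hε)
    change dist x (d n) < ε / 2 at hn
    rw [dist_comm, dist_eq_norm] at hn
    have hd : ‖g (d n) (d n)‖ = ‖d n‖ := by rw [hgx]; simp
    have hdx : ‖g (d n) (d n - x)‖ ≤ ‖d n - x‖ := by
      simpa using (g (d n)).le_of_opNorm_le (hg _) (d n - x)
    have hsplit : ‖g (d n) (d n)‖ ≤ ‖g (d n) x‖ + ‖g (d n) (d n - x)‖ := by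
      simpa using norm_add_le (g (d n) x) (g (d n) (d n - x))
    have htri : ‖x‖ ≤ ‖d n‖ + ‖d n - x‖ := norm_le_norm_add_norm_sub (d n) x
    have := h n
    linarith

/-- In a second-countable metric space, a sigma-algebra containing all closed balls contains the
Borel sigma-algebra. -/
theorem borel_le_of_measurableSet_closedBall {X : Type*} [PseudoMetricSpace X]
    [SecondCountableTopology X] {m : MeasurableSpace X}
    (hm : ∀ (a : X) (r : ℝ), MeasurableSet (Metric.closedBall a r)) : borel X ≤ m := by
  refine MeasurableSpace.generateFrom_le fun U (hU : IsOpen U) => ?_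
  have hball : ∀ x, ∃ r : ℝ, 0 < r ∧ (x ∈ U → Metric.closedBall x r ⊆ U) := fun x => by
    by_cases hx : x ∈ U
    · obtain ⟨r, hr, h⟩ := Metric.nhds_basis_closedBall.mem_iff.1 (hU.mem_nhds hx)
      exact ⟨r, hr, fun _ => h⟩
    · exact ⟨1, one_pos, fun h => absurd h hx⟩
  choose r hr hrU using hball
  obtain ⟨T, hTU, hTc, hT⟩ := TopologicalSpace.isOpen_biUnion_countable U
    (fun x => Metric.ball x (r x)) (fun _ _ => Metric.isOpen_ball)
  have hUT : U = ⋃ x ∈ T, Metric.closedBall x (r x) := by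
    refine Set.Subset.antisymm (fun x hx => ?_) (Set.iUnion₂_subset fun x hx => hrU x (hTU hx))
    have hxT : x ∈ ⋃ i ∈ T, Metric.ball i (r i) :=
      hT ▸ Set.mem_biUnion hx (Metric.mem_ball_self (hr x))
    exact Set.iUnion₂_mono (fun _ _ => Metric.ball_subset_closedBall) hxT
  rw [hUT]
  exact MeasurableSet.biUnion hTc fun x _ => hm x (r x)

/-- Proposition 4.8 in the paper: linear characterization of the Borel sigma-algebra of a
separable normed `𝕜`-vector space (`𝕜 ∈ {ℝ, ℂ}`). -/
theorem stmt_10 {𝕜 : Type*} [RCLike 𝕜]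
    {V : Type*} [NormedAddCommGroup V] [NormedSpace 𝕜 V]
    [TopologicalSpace.SeparableSpace V] :
    ∃ φ : ℕ → (V →L[𝕜] 𝕜),
      borel V = (⨆ ψ : V →L[𝕜] 𝕜, MeasurableSpace.comap (⇑ψ) (borel 𝕜))
      ∧ borel V = ⨆ n : ℕ, MeasurableSpace.comap (⇑(φ n)) (borel 𝕜) := by
  obtain ⟨φ, hφ⟩ := exists_seq_dual_norming 𝕜 V
  have : SecondCountableTopology V := UniformSpace.secondCountable_of_separable V
  have hall : (⨆ ψ : V →L[𝕜] 𝕜, MeasurableSpace.comap (⇑ψ) (borel 𝕜)) ≤ borel V :=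
    iSup_le fun ψ => ψ.continuous.borel_measurable.comap_le
  have hseq : (⨆ n : ℕ, MeasurableSpace.comap (⇑(φ n)) (borel 𝕜)) ≤
      ⨆ ψ : V →L[𝕜] 𝕜, MeasurableSpace.comap (⇑ψ) (borel 𝕜) :=
    iSup_le fun n => le_iSup (fun ψ : V →L[𝕜] 𝕜 => MeasurableSpace.comap (⇑ψ) (borel 𝕜)) (φ n)
  have hborel : borel V ≤ ⨆ n : ℕ, MeasurableSpace.comap (⇑(φ n)) (borel 𝕜) := by
    refine borel_le_of_measurableSet_closedBall fun a r => ?_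
    have hball : Metric.closedBall a r = ⋂ n, φ n ⁻¹' Metric.closedBall (φ n a) r := by
      ext x
      simp [dist_eq_norm, hφ (x - a) r]
    rw [hball]
    refine MeasurableSet.iInter fun n => ?_
    refine le_iSup (fun n => MeasurableSpace.comap (⇑(φ n)) (borel 𝕜)) n _ ⟨_, ?_, rfl⟩
    exact @IsClosed.measurableSet _ _ _ (borel 𝕜) (@BorelSpace.opensMeasurable _ _ (borel 𝕜) ⟨rfl⟩)
      Metric.isClosed_closedBall
  exact ⟨φ, le_antisymm (hborel.trans hseq) hall, le_antisymm hborel (hseq.trans hall)⟩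
end

section
/- (Independent projections imply independence.) Let (V₁,‖·‖_{V₁}) and (V₂,‖·‖_{V₂}) be separable normed real vector spaces, let (Ω,𝔉,ℙ) be a probability space, and let X₁ : Ω → V₁ and X₂ : Ω → V₂ be functions such that for all continuous linear functionals φ₁ ∈ (V₁)' and φ₂ ∈ (V₂)' the real-valued functions φ₁∘X₁ and φ₂∘X₂ are independent random variables (in particular each is 𝔉/𝓑(ℝ)-measurable). Then X₁ and X₂ are (Borel measurable and) independent random variables, i.e. the joint law of (X₁,X₂) on 𝓑(V₁)⊗𝓑(V₂) equals the product of the laws of X₁ and X₂. -/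
open MeasureTheory

/-- A separable real normed space has a countable family of continuous linear functionals
which determines the norm. -/
lemma exists_seq_strongDual_norm_le_iff (E : Type*) [NormedAddCommGroup E] [NormedSpace ℝ E]
    [TopologicalSpace.SeparableSpace E] :
    ∃ g : ℕ → StrongDual ℝ E, ∀ (x : E) (r : ℝ), ‖x‖ ≤ r ↔ ∀ n, g n x ≤ r := by
  choose g hg_norm hg_apply using fun n ↦
    exists_dual_vector'' ℝ (TopologicalSpace.denseSeq E n)
  have hg_le (n : ℕ) (y : E) : g n y ≤ ‖y‖ :=
    (le_abs_self _).trans (((g n).le_of_opNorm_le (hg_norm n) y).trans_eq (one_mul _))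
  refine ⟨g, fun x r ↦ ⟨fun h n ↦ (hg_le n x).trans h, fun h ↦ ?_⟩⟩
  refine le_of_forall_pos_le_add fun ε hε ↦ ?_
  obtain ⟨n, hn⟩ := (TopologicalSpace.denseRange_denseSeq E).exists_dist_lt x (half_pos hε)
  rw [dist_eq_norm] at hn
  set d := TopologicalSpace.denseSeq E n
  have hd : g n d = ‖d‖ := hg_apply n
  have h₁ : ‖x‖ ≤ ‖x - d‖ + ‖d‖ := by simpa using norm_add_le (x - d) d
  have h₂ : g n d - g n x ≤ ‖x - d‖ := by
    rw [← map_sub, norm_sub_rev]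
    exact hg_le n (d - x)
  linarith [h n]

/-- A map into a separable real normed space is Borel measurable if all its compositions with
continuous linear functionals are measurable. -/
lemma measurable_of_forall_strongDual {Ω E : Type*} [MeasurableSpace Ω]
    [NormedAddCommGroup E] [NormedSpace ℝ E] [TopologicalSpace.SeparableSpace E]
    [MeasurableSpace E] [BorelSpace E] {X : Ω → E}
    (hX : ∀ L : StrongDual ℝ E, Measurable fun ω ↦ L (X ω)) : Measurable X := by
  have : SecondCountableTopology E := UniformSpace.secondCountable_of_separable E
  obtain ⟨g, hg⟩ := exists_seq_strongDual_norm_le_iff E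
  have hball (c : E) (r : ℝ) : MeasurableSet (X ⁻¹' Metric.closedBall c r) := by
    have : X ⁻¹' Metric.closedBall c r = ⋂ n, {ω | g n (X ω) ≤ r + g n c} := by
      ext ω
      simp [dist_eq_norm, hg]
    rw [this]
    exact .iInter fun n ↦ measurableSet_le (hX _) measurable_const
  refine measurable_of_isOpen fun s hs ↦ ?_
  have hr (x : E) : ∃ r > 0, x ∈ s → Metric.closedBall x r ⊆ s := by
    by_cases hx : x ∈ s
    · obtain ⟨r, hr, h⟩ := Metric.nhds_basis_closedBall.mem_iff.1 (hs.mem_nhds hx)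
      exact ⟨r, hr, fun _ ↦ h⟩
    · exact ⟨1, one_pos, fun h ↦ absurd h hx⟩
  choose r hr_pos hr_sub using hr
  obtain ⟨t, hts, ht, hst⟩ := TopologicalSpace.countable_cover_nhdsWithin
    (f := fun x ↦ Metric.closedBall x (r x)) (s := s)
    fun x _ ↦ mem_nhdsWithin_of_mem_nhds (Metric.closedBall_mem_nhds x (hr_pos x))
  have hs_eq : s = ⋃ x ∈ t, Metric.closedBall x (r x) :=
    hst.antisymm (Set.iUnion₂_subset fun x hx ↦ hr_sub x (hts hx))
  rw [hs_eq, Set.preimage_iUnion₂]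
  exact .biUnion ht fun x _ ↦ hball x _

/-- A topology-inducing map also induces the Borel sigma-algebra. -/
lemma Topology.IsInducing.comap_measurableSpace_eq {α β : Type*}
    [TopologicalSpace α] [mα : MeasurableSpace α] [BorelSpace α]
    [TopologicalSpace β] [mβ : MeasurableSpace β] [BorelSpace β]
    {f : α → β} (hf : Topology.IsInducing f) : mβ.comap f = mα := by
  rw [BorelSpace.measurable_eq (α := α), BorelSpace.measurable_eq (α := β), ← borel_comap,
    ← hf.eq_induced]

namespace ProbabilityTheory

variable {Ω E F : Type*} [MeasurableSpace Ω] {μ : Measure Ω}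
  [NormedAddCommGroup E] [NormedSpace ℝ E] [MeasurableSpace E] [BorelSpace E]
  [NormedAddCommGroup F] [NormedSpace ℝ F] [MeasurableSpace F] [BorelSpace F]
  {X : Ω → E} {Y : Ω → F}

/-- Two random variables in separable Banach spaces are independent if all their
one-dimensional projections are. -/
lemma indepFun_of_forall_strongDual_of_completeSpace [IsFiniteMeasure μ]
    [CompleteSpace E] [SecondCountableTopology E] [CompleteSpace F] [SecondCountableTopology F]
    (hX : Measurable X) (hY : Measurable Y)
    (h : ∀ (L : StrongDual ℝ E) (M : StrongDual ℝ F),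
      IndepFun (fun ω ↦ L (X ω)) (fun ω ↦ M (Y ω)) μ) :
    IndepFun X Y μ := by
  rw [indepFun_iff_charFunDual_prod hX.aemeasurable hY.aemeasurable]
  intro L
  have hadd := (h (L.comp (.inl ℝ E F)) (L.comp (.inr ℝ E F))).charFun_map_fun_add_eq_mul
    (by fun_prop) (by fun_prop)
  simp only [charFunDual_eq_charFun_map_one]
  rw [Measure.map_map (by fun_prop) (by fun_prop), Measure.map_map (by fun_prop) hX,
    Measure.map_map (by fun_prop) hY]
  convert congrFun hadd 1 using 4 with ω
  · simp [← map_add]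
  · rfl

/-- Two random variables in separable normed spaces are independent if all their
one-dimensional projections are. -/
lemma indepFun_of_forall_strongDual [IsFiniteMeasure μ]
    [TopologicalSpace.SeparableSpace E] [TopologicalSpace.SeparableSpace F]
    (hX : Measurable X) (hY : Measurable Y)
    (h : ∀ (L : StrongDual ℝ E) (M : StrongDual ℝ F),
      IndepFun (fun ω ↦ L (X ω)) (fun ω ↦ M (Y ω)) μ) :
    IndepFun X Y μ := by
  let ιE : E →L[ℝ] UniformSpace.Completion E := UniformSpace.Completion.toComplL
  let ιF : F →L[ℝ] UniformSpace.Completion F := UniformSpace.Completion.toComplL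
  borelize (UniformSpace.Completion E) (UniformSpace.Completion F)
  have : SecondCountableTopology (UniformSpace.Completion E) :=
    UniformSpace.secondCountable_of_separable _
  have : SecondCountableTopology (UniformSpace.Completion F) :=
    UniformSpace.secondCountable_of_separable _
  have hind : IndepFun (fun ω ↦ ιE (X ω)) (fun ω ↦ ιF (Y ω)) μ :=
    indepFun_of_forall_strongDual_of_completeSpace (by fun_prop) (by fun_prop)
      fun L M ↦ h (L.comp ιE) (M.comp ιF)
  have hE : MeasurableSpace.comap ιE inferInstance = ‹MeasurableSpace E› :=
    (UniformSpace.Completion.isUniformInducing_coe E).isInducing.comap_measurableSpace_eq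
  have hF : MeasurableSpace.comap ιF inferInstance = ‹MeasurableSpace F› :=
    (UniformSpace.Completion.isUniformInducing_coe F).isInducing.comap_measurableSpace_eq
  rw [IndepFun_iff_Indep] at hind ⊢
  rw [← hE, ← hF, MeasurableSpace.comap_comp, MeasurableSpace.comap_comp]
  exact hind

end ProbabilityTheory

/-- Lemma 4.12 in the paper: if all one-dimensional projections of `X₁` and `X₂` are
independent, then `X₁` and `X₂` are independent random variables. -/
theorem stmt_12 {V₁ V₂ : Type*}
    [NormedAddCommGroup V₁] [NormedSpace ℝ V₁] [TopologicalSpace.SeparableSpace V₁]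
    [MeasurableSpace V₁] [BorelSpace V₁]
    [NormedAddCommGroup V₂] [NormedSpace ℝ V₂] [TopologicalSpace.SeparableSpace V₂]
    [MeasurableSpace V₂] [BorelSpace V₂]
    {Ω : Type*} [MeasurableSpace Ω] (μ : Measure Ω) [IsProbabilityMeasure μ]
    (X₁ : Ω → V₁) (X₂ : Ω → V₂)
    (hmeas₁ : ∀ φ₁ : V₁ →L[ℝ] ℝ, Measurable fun ω => φ₁ (X₁ ω))
    (hmeas₂ : ∀ φ₂ : V₂ →L[ℝ] ℝ, Measurable fun ω => φ₂ (X₂ ω))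
    (hindep : ∀ (φ₁ : V₁ →L[ℝ] ℝ) (φ₂ : V₂ →L[ℝ] ℝ),
      ProbabilityTheory.IndepFun (fun ω => φ₁ (X₁ ω)) (fun ω => φ₂ (X₂ ω)) μ) :
    Measurable X₁ ∧ Measurable X₂ ∧
      Measure.map (fun ω => (X₁ ω, X₂ ω)) μ = (Measure.map X₁ μ).prod (Measure.map X₂ μ) := by
  have hX₁ := measurable_of_forall_strongDual hmeas₁
  have hX₂ := measurable_of_forall_strongDual hmeas₂
  exact ⟨hX₁, hX₂, (ProbabilityTheory.indepFun_iff_map_prod_eq_prod_map_map hX₁.aemeasurable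
    hX₂.aemeasurable).1 (ProbabilityTheory.indepFun_of_forall_strongDual hX₁ hX₂ hindep)⟩
end

section
/- (Orthogonal transformations of independent Gaussian random variables.) Let (V,‖·‖_V) be a separable normed real vector space, let (Ω,𝔉,ℙ) be a probability space, let X₁, X₂ : Ω → V be independent Borel-measurable random variables such that for every continuous linear functional φ ∈ V' the real random variables φ∘X₁ and φ∘X₂ are identically distributed centered Gaussian random variables, and let Y₁, Y₂ : Ω → V satisfy Y₁ = 2^{−1/2}(X₁ + X₂) and Y₂ = 2^{−1/2}(X₁ − X₂). Then (i) Y₁ and Y₂ are independent random variables, and (ii) the laws of Y₁, Y₂, X₁ and X₂ on (V,𝓑(V)) all coincide. -/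
open MeasureTheory

/-- A measure on a Borel space is determined by its pushforward under an inducing map. -/
lemma MeasureTheory.Measure.ext_of_map_isInducing {α β : Type*}
    [TopologicalSpace α] [MeasurableSpace α] [BorelSpace α]
    [TopologicalSpace β] [MeasurableSpace β] [BorelSpace β]
    {f : α → β} (hf : Topology.IsInducing f) {μ ν : Measure α}
    (h : μ.map f = ν.map f) : μ = ν := by
  ext s hs
  have hs' : MeasurableSet[(borel β).comap f] s := by
    rwa [← borel_comap, ← hf.eq_induced, ← BorelSpace.measurable_eq (α := α)]
  obtain ⟨t, ht, rfl⟩ := hs'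
  rw [← BorelSpace.measurable_eq (α := β)] at ht
  have hfm : Measurable f := hf.continuous.measurable
  rw [← Measure.map_apply hfm ht, h, Measure.map_apply hfm ht]

open UniformSpace in
/-- Two finite measures on a separable normed space, not necessarily complete, are equal if they
have the same characteristic function. -/
lemma MeasureTheory.Measure.ext_of_charFunDual_of_secondCountable {E : Type*}
    [NormedAddCommGroup E] [NormedSpace ℝ E] [SecondCountableTopology E]
    [MeasurableSpace E] [BorelSpace E] {μ ν : Measure E} [IsFiniteMeasure μ] [IsFiniteMeasure ν]
    (h : charFunDual μ = charFunDual ν) : μ = ν := by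
  borelize (Completion E)
  have : SecondCountableTopology (Completion E) :=
    UniformSpace.secondCountable_of_separable _
  let ι : E →L[ℝ] Completion E := Completion.toComplL
  have hι : Topology.IsInducing ι := Completion.isUniformInducing_coe E |>.isInducing
  refine Measure.ext_of_map_isInducing hι (Measure.ext_of_charFunDual ?_)
  ext L
  rw [charFunDual_map, charFunDual_map, h]

open ContinuousLinearMap UniformSpace in
/-- For a centered Gaussian measure `μ` on a separable normed space, not necessarily complete,
the product measure `μ.prod μ` is invariant under rotation. -/
lemma ProbabilityTheory.IsGaussian.map_rotation_prod_self {E : Type*}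
    [NormedAddCommGroup E] [NormedSpace ℝ E] [SecondCountableTopology E]
    [MeasurableSpace E] [BorelSpace E] {μ : Measure E} [ProbabilityTheory.IsGaussian μ]
    (hμ : ∀ L : StrongDual ℝ E, ∫ x, L x ∂μ = 0) (θ : ℝ) :
    (μ.prod μ).map (rotation θ) = μ.prod μ := by
  borelize (Completion E)
  have : SecondCountableTopology (Completion E) :=
    UniformSpace.secondCountable_of_separable _
  let ι : E →L[ℝ] Completion E := Completion.toComplL
  have hι : Topology.IsInducing ι := Completion.isUniformInducing_coe E |>.isInducing
  have hιm : Measurable ι := ι.continuous.measurable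
  have hcentered (L : StrongDual ℝ (Completion E)) : ∫ x, L x ∂(μ.map ι) = 0 := by
    rw [integral_map hιm.aemeasurable (by fun_prop)]
    exact hμ (L.comp ι)
  refine Measure.ext_of_map_isInducing (hι.prodMap hι) ?_
  have hcomm : Prod.map ι ι ∘ rotation (E := E) θ = rotation θ ∘ Prod.map ι ι := by
    ext1 x
    simp [ContinuousLinearMap.rotation_apply]
  rw [Measure.map_map (hιm.prodMap hιm) (by fun_prop), hcomm,
    ← Measure.map_map (by fun_prop) (hιm.prodMap hιm), ← Measure.map_prod_map _ _ hιm hιm]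
  exact map_rotation_eq_self_of_forall_strongDual_eq_zero hcentered θ

/-- Lemma 4.13 in the paper: orthogonal transformations of independent identically
distributed centered Gaussian random variables are again independent, with the same
distribution. -/
theorem stmt_13 {V : Type*} [NormedAddCommGroup V] [NormedSpace ℝ V]
    [TopologicalSpace.SeparableSpace V] [MeasurableSpace V] [BorelSpace V]
    {Ω : Type*} [MeasurableSpace Ω] (μ : Measure Ω) [IsProbabilityMeasure μ]
    (X₁ X₂ Y₁ Y₂ : Ω → V)
    (hX₁ : Measurable X₁) (hX₂ : Measurable X₂)
    (hindep : ProbabilityTheory.IndepFun X₁ X₂ μ)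
    (hGauss : ∀ φ : V →L[ℝ] ℝ,
      Measure.map (fun ω => φ (X₁ ω)) μ = Measure.map (fun ω => φ (X₂ ω)) μ
      ∧ ∃ v : NNReal,
          Measure.map (fun ω => φ (X₁ ω)) μ = ProbabilityTheory.gaussianReal 0 v)
    (hY₁ : ∀ ω, Y₁ ω = ((2:ℝ) ^ (-(1:ℝ)/2)) • (X₁ ω + X₂ ω))
    (hY₂ : ∀ ω, Y₂ ω = ((2:ℝ) ^ (-(1:ℝ)/2)) • (X₁ ω - X₂ ω)) :
    ProbabilityTheory.IndepFun Y₁ Y₂ μ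
    ∧ Measure.map Y₁ μ = Measure.map X₁ μ
    ∧ Measure.map Y₂ μ = Measure.map X₁ μ
    ∧ Measure.map X₂ μ = Measure.map X₁ μ := by
  have : SecondCountableTopology V := UniformSpace.secondCountable_of_separable V
  have hlaw : Measure.map X₂ μ = Measure.map X₁ μ := by
    have := Measure.isProbabilityMeasure_map (μ := μ) hX₁.aemeasurable
    have := Measure.isProbabilityMeasure_map (μ := μ) hX₂.aemeasurable
    refine Measure.ext_of_charFunDual_of_secondCountable ?_
    ext L
    rw [charFunDual_eq_charFun_map_one,
      charFunDual_eq_charFun_map_one, Measure.map_map (by fun_prop) hX₁,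
      Measure.map_map (by fun_prop) hX₂]
    exact congrArg (charFun · 1) (hGauss L).1.symm
  set ν := Measure.map X₁ μ with hν
  have hmap (φ : StrongDual ℝ V) : ∃ v, ν.map φ = ProbabilityTheory.gaussianReal 0 v := by
    rw [hν, Measure.map_map (by fun_prop) hX₁]
    exact (hGauss φ).2
  have : ProbabilityTheory.IsGaussian ν :=
    ProbabilityTheory.isGaussian_of_map_eq_gaussianReal fun φ ↦ ⟨0, hmap φ⟩
  have hcentered (φ : StrongDual ℝ V) : ∫ x, φ x ∂ν = 0 := by
    obtain ⟨v, hv⟩ := hmap φ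
    have h := integral_map (μ := ν) (φ := φ) (f := fun x : ℝ ↦ x) (by fun_prop) (by fun_prop)
    rw [← h, hv, ProbabilityTheory.integral_id_gaussianReal]
  have hpair : μ.map (fun ω ↦ (X₂ ω, X₁ ω)) = ν.prod ν := by
    rw [(ProbabilityTheory.indepFun_iff_map_prod_eq_prod_map_map hX₂.aemeasurable
      hX₁.aemeasurable).1 hindep.symm, hlaw]
  have hsqrt : (2 : ℝ) ^ (-(1 : ℝ) / 2) = √2 / 2 := by
    rw [neg_div, Real.rpow_neg (by norm_num), ← Real.sqrt_eq_rpow, Real.sqrt_div_self', one_div]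
  have hY₁m : Measurable Y₁ := by
    rw [funext hY₁]
    fun_prop
  have hY₂m : Measurable Y₂ := by
    rw [funext hY₂]
    fun_prop
  have hrot : (fun ω ↦ (Y₁ ω, Y₂ ω)) =
      ContinuousLinearMap.rotation (Real.pi / 4) ∘ fun ω ↦ (X₂ ω, X₁ ω) := by
    ext1 ω
    simp only [Function.comp_apply, ContinuousLinearMap.rotation_apply, hY₁, hY₂, hsqrt,
      Real.cos_pi_div_four, Real.sin_pi_div_four, Prod.mk.injEq]
    constructor <;> module
  have hY : μ.map (fun ω ↦ (Y₁ ω, Y₂ ω)) = ν.prod ν := by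
    rw [hrot, ← Measure.map_map (by fun_prop) (by fun_prop), hpair,
      ProbabilityTheory.IsGaussian.map_rotation_prod_self hcentered]
  have hfst : μ.map Y₁ = ν := by
    rw [← Measure.fst_map_prodMk hY₂m, hY, Measure.fst_prod]
  have hsnd : μ.map Y₂ = ν := by
    rw [← Measure.snd_map_prodMk hY₁m, hY, Measure.snd_prod]
  refine ⟨?_, hfst, hsnd, hlaw⟩
  rw [ProbabilityTheory.indepFun_iff_map_prod_eq_prod_map_map hY₁m.aemeasurable
    hY₂m.aemeasurable, hY, hfst, hsnd]
end

section
/- (Fernique's theorem with explicit constants.) Let (V,‖·‖_V) be a separable normed real vector space, let (Ω,𝔉,ℙ) be a probability space, let X : Ω → V be a Borel-measurable function such that for every continuous linear functional φ ∈ V' the real random variable φ∘X is a centered Gaussian random variable, and let R ∈ (0,∞) satisfy R ≥ inf{r ∈ [0,∞) : ℙ(‖X‖_V ≤ r) ≥ 9/10}. Then 𝔼[exp(‖X‖_V² / (18 R²))] ≤ √e + Σ_{n=0}^∞ (e/3)^{2ⁿ} < 13 < ∞. -/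
open MeasureTheory

open ProbabilityTheory Set Filter Metric in
open scoped ENNReal in
/-- The tail of a rotation-invariant probability measure that gives mass at least `9 / 10` to the
ball of radius `R` decays doubly exponentially along the sequence `normThreshold R`. -/
lemma measure_gt_normThreshold_le_ninth_pow {E : Type*} [NormedAddCommGroup E] [NormedSpace ℝ E]
    [SecondCountableTopology E] [MeasurableSpace E] [BorelSpace E] (ν : Measure E)
    [IsProbabilityMeasure ν]
    (hrot : (ν.prod ν).map (ContinuousLinearMap.rotation (-(Real.pi / 4))) = ν.prod ν)
    {R : ℝ} (hR : (9 / 10 : ℝ≥0∞) ≤ ν {x | ‖x‖ ≤ R}) (n : ℕ) :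
    ν {x | Fernique.normThreshold R n < ‖x‖} ≤ ENNReal.ofReal ((1 / 9) ^ 2 ^ n) := by
  have hhalf : (2⁻¹ : ℝ≥0∞) < 9 / 10 := by
    rw [← ENNReal.toReal_lt_toReal (by finiteness) (by finiteness)]
    norm_num
  refine (Fernique.measure_gt_normThreshold_le_rpow hrot (hhalf.trans_le hR) n).trans ?_
  have hratio : (1 - ν {x | ‖x‖ ≤ R}) / ν {x | ‖x‖ ≤ R} ≤ ENNReal.ofReal (1 / 9) := by
    calc (1 - ν {x | ‖x‖ ≤ R}) / ν {x | ‖x‖ ≤ R}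
        ≤ (1 - 9 / 10) / (9 / 10) := by gcongr
      _ = ENNReal.ofReal (1 / 9) := by
        have hfin : ((1 - 9 / 10) / (9 / 10) : ℝ≥0∞) ≠ ∞ :=
          ENNReal.div_ne_top (by finiteness) (by norm_num)
        rw [← ENNReal.ofReal_toReal hfin, ENNReal.toReal_div,
          ENNReal.toReal_sub_of_le _ (by finiteness)]
        · norm_num
        · rw [← ENNReal.toReal_le_toReal (by finiteness) (by finiteness)]
          norm_num
  calc ν {x | ‖x‖ ≤ R} * ((1 - ν {x | ‖x‖ ≤ R}) / ν {x | ‖x‖ ≤ R}) ^ 2 ^ n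
      ≤ 1 * ENNReal.ofReal (1 / 9) ^ 2 ^ n := by
        gcongr
        exact prob_le_one
    _ = ENNReal.ofReal ((1 / 9) ^ 2 ^ n) := by
        rw [one_mul, ENNReal.ofReal_pow (by norm_num)]

open ProbabilityTheory in
lemma sq_normThreshold_add_one_div_le {R : ℝ} (hR0 : 0 < R) (n : ℕ) :
    Fernique.normThreshold R (n + 1) ^ 2 / (18 * R ^ 2) ≤ 2 * 2 ^ n := by
  rw [div_le_iff₀ (by positivity)]
  have hsqrt : (1 + √2) ^ 2 ≤ 9 := by
    nlinarith [Real.sq_sqrt (show (0 : ℝ) ≤ 2 by norm_num), Real.sqrt_nonneg 2]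
  calc Fernique.normThreshold R (n + 1) ^ 2
      ≤ R ^ 2 * (1 + √2) ^ 2 * 2 ^ (n + 2) := Fernique.sq_normThreshold_add_one_le n
    _ ≤ R ^ 2 * 9 * 2 ^ (n + 2) := by gcongr
    _ = 2 * 2 ^ n * (18 * R ^ 2) := by ring

lemma exp_mul_ninth_pow_le (n : ℕ) :
    Real.exp (2 * 2 ^ n) * (1 / 9) ^ 2 ^ n ≤ (Real.exp 1 / 3) ^ 2 ^ n := by
  have hexp : Real.exp (2 * 2 ^ n) = (Real.exp 1 ^ 2) ^ 2 ^ n := by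
    rw [← pow_mul, ← Real.exp_nat_mul]
    push_cast
    rw [mul_one]
  rw [hexp, ← mul_pow]
  gcongr
  nlinarith [Real.exp_one_lt_d9, Real.exp_pos 1]

lemma exp_one_div_three_pow_two_pow_le (n : ℕ) :
    (Real.exp 1 / 3) ^ 2 ^ n ≤ 0.907 * 0.907 ^ n := by
  calc (Real.exp 1 / 3) ^ 2 ^ n
      ≤ 0.907 ^ 2 ^ n := by
        gcongr
        linarith [Real.exp_one_lt_d9]
    _ ≤ 0.907 ^ (n + 1) :=
        pow_le_pow_of_le_one (by norm_num) (by norm_num) Nat.lt_two_pow_self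
    _ = 0.907 * 0.907 ^ n := pow_succ' _ _

lemma summable_exp_one_div_three_pow_two_pow :
    Summable fun n : ℕ ↦ (Real.exp 1 / 3) ^ 2 ^ n :=
  .of_nonneg_of_le (fun n ↦ by positivity) exp_one_div_three_pow_two_pow_le
    ((summable_geometric_of_lt_one (by norm_num) (by norm_num)).mul_left _)

lemma sqrt_exp_one_add_tsum_lt :
    √(Real.exp 1) + ∑' n : ℕ, (Real.exp 1 / 3) ^ 2 ^ n < 13 := by
  have hsum : ∑' n : ℕ, (Real.exp 1 / 3) ^ 2 ^ n ≤ ∑' n : ℕ, 0.907 * (0.907 : ℝ) ^ n :=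
    summable_exp_one_div_three_pow_two_pow.tsum_le_tsum exp_one_div_three_pow_two_pow_le
      ((summable_geometric_of_lt_one (by norm_num) (by norm_num)).mul_left _)
  rw [tsum_mul_left, tsum_geometric_of_lt_one (by norm_num) (by norm_num)] at hsum
  have hsqrt : √(Real.exp 1) ≤ 2 :=
    Real.sqrt_le_iff.mpr ⟨by norm_num, by linarith [Real.exp_one_lt_d9]⟩
  norm_num at hsum
  linarith

open ProbabilityTheory Set Filter Metric in
open scoped ENNReal in
/-- Fernique's bound for a rotation-invariant probability measure that gives mass at least `9 / 10`
to the ball of radius `R`. -/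
lemma lintegral_exp_sq_norm_le_of_map_rotation_eq_self {E : Type*} [NormedAddCommGroup E]
    [NormedSpace ℝ E] [SecondCountableTopology E] [MeasurableSpace E] [BorelSpace E]
    (ν : Measure E) [IsProbabilityMeasure ν]
    (hrot : (ν.prod ν).map (ContinuousLinearMap.rotation (-(Real.pi / 4))) = ν.prod ν)
    {R : ℝ} (hR0 : 0 < R) (hR : (9 / 10 : ℝ≥0∞) ≤ ν {x | ‖x‖ ≤ R}) :
    ∫⁻ x, ENNReal.ofReal (Real.exp (‖x‖ ^ 2 / (18 * R ^ 2))) ∂ν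
      ≤ ENNReal.ofReal (√(Real.exp 1) + ∑' n : ℕ, (Real.exp 1 / 3) ^ 2 ^ n) := by
  set t := Fernique.normThreshold R
  set f : E → ℝ≥0∞ := fun x ↦ ENNReal.ofReal (Real.exp (‖x‖ ^ 2 / (18 * R ^ 2)))
  have hcover : (univ : Set E)
      = closedBall 0 R ∪ ⋃ n, closedBall 0 (t (n + 1)) \ closedBall 0 (t n) := by
    refine (eq_univ_of_forall fun x ↦ ?_).symm
    rcases le_or_gt ‖x‖ R with hx | hx
    · exact .inl (by simpa using hx)
    · obtain ⟨n, hn⟩ := (Fernique.normThreshold_strictMono hR0).exists_between_of_tendsto_atTop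
        (Fernique.tendsto_normThreshold_atTop hR0) hx
      exact .inr (mem_iUnion.mpr ⟨n, by simpa using hn.2, by simpa using hn.1⟩)
  have hball : ∫⁻ x in closedBall 0 R, f x ∂ν ≤ ENNReal.ofReal √(Real.exp 1) := by
    calc ∫⁻ x in closedBall 0 R, f x ∂ν
        ≤ ∫⁻ _ in closedBall (0 : E) R, ENNReal.ofReal √(Real.exp 1) ∂ν := by
          refine setLIntegral_mono (by fun_prop) fun x hx ↦ ?_
          have hx' : ‖x‖ ≤ R := by simpa using hx
          rw [← Real.exp_half]
          refine ENNReal.ofReal_le_ofReal (Real.exp_le_exp.mpr ?_)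
          rw [div_le_iff₀ (by positivity)]
          nlinarith [norm_nonneg x]
      _ ≤ ENNReal.ofReal √(Real.exp 1) := by
          rw [setLIntegral_const]
          exact mul_le_of_le_one_right' prob_le_one
  have hannulus (n : ℕ) : ∫⁻ x in closedBall 0 (t (n + 1)) \ closedBall 0 (t n), f x ∂ν
      ≤ ENNReal.ofReal ((Real.exp 1 / 3) ^ 2 ^ n) := by
    calc ∫⁻ x in closedBall 0 (t (n + 1)) \ closedBall 0 (t n), f x ∂ν
        ≤ ∫⁻ _ in closedBall (0 : E) (t (n + 1)) \ closedBall 0 (t n),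
            ENNReal.ofReal (Real.exp (2 * 2 ^ n)) ∂ν := by
          refine setLIntegral_mono (by fun_prop) fun x hx ↦ ?_
          have hx' : ‖x‖ ≤ t (n + 1) := by simpa using hx.1
          refine ENNReal.ofReal_le_ofReal (Real.exp_le_exp.mpr ?_)
          refine le_trans ?_ (sq_normThreshold_add_one_div_le hR0 n)
          gcongr
      _ = ENNReal.ofReal (Real.exp (2 * 2 ^ n))
            * ν (closedBall (0 : E) (t (n + 1)) \ closedBall 0 (t n)) := setLIntegral_const _ _
      _ ≤ ENNReal.ofReal (Real.exp (2 * 2 ^ n)) * ν {x | t n < ‖x‖} := by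
          gcongr
          intro x hx
          simpa using hx.2
      _ ≤ ENNReal.ofReal (Real.exp (2 * 2 ^ n)) * ENNReal.ofReal ((1 / 9) ^ 2 ^ n) := by
          gcongr
          exact measure_gt_normThreshold_le_ninth_pow ν hrot hR n
      _ ≤ ENNReal.ofReal ((Real.exp 1 / 3) ^ 2 ^ n) := by
          rw [← ENNReal.ofReal_mul (by positivity)]
          exact ENNReal.ofReal_le_ofReal (exp_mul_ninth_pow_le n)
  calc ∫⁻ x, f x ∂ν
      = ∫⁻ x in closedBall 0 R ∪ ⋃ n, closedBall 0 (t (n + 1)) \ closedBall 0 (t n), f x ∂ν := by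
        rw [← hcover, setLIntegral_univ]
    _ ≤ ∫⁻ x in closedBall 0 R, f x ∂ν
          + ∑' n, ∫⁻ x in closedBall 0 (t (n + 1)) \ closedBall 0 (t n), f x ∂ν :=
        (lintegral_union_le _ _ _).trans (by gcongr; exact lintegral_iUnion_le _ _)
    _ ≤ ENNReal.ofReal √(Real.exp 1) + ∑' n : ℕ, ENNReal.ofReal ((Real.exp 1 / 3) ^ 2 ^ n) :=
        add_le_add hball (ENNReal.tsum_le_tsum hannulus)
    _ = ENNReal.ofReal (√(Real.exp 1) + ∑' n : ℕ, (Real.exp 1 / 3) ^ 2 ^ n) := by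
        rw [ENNReal.ofReal_add (by positivity) (tsum_nonneg fun n ↦ by positivity),
          ENNReal.ofReal_tsum_of_nonneg (fun n ↦ by positivity)
            summable_exp_one_div_three_pow_two_pow]

open Filter Topology in
open scoped ENNReal in
/-- If `R` bounds the `c`-quantile of `Y` for some `c < 1`, then `Y ≤ R` has probability at
least `c`. -/
lemma le_measure_le_of_sInf_le {Ω : Type*} [MeasurableSpace Ω] (μ : Measure Ω)
    [IsProbabilityMeasure μ] {Y : Ω → ℝ} (hY : Measurable Y) {c : ℝ≥0∞} (hc : c < 1) {R : ℝ}
    (hR : sInf {r : ℝ | 0 ≤ r ∧ c ≤ μ {ω | Y ω ≤ r}} ≤ R) : c ≤ μ {ω | Y ω ≤ R} := by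
  have hne : {r : ℝ | 0 ≤ r ∧ c ≤ μ {ω | Y ω ≤ r}}.Nonempty := by
    have hlim : Tendsto (fun r : ℝ ↦ μ {ω | Y ω ≤ r}) atTop (𝓝 (μ (⋃ r : ℝ, {ω | Y ω ≤ r}))) :=
      tendsto_measure_iUnion_atTop fun _ _ hrs _ hω ↦ le_trans hω hrs
    have huniv : ⋃ r : ℝ, {ω | Y ω ≤ r} = Set.univ :=
      Set.eq_univ_of_forall fun ω ↦ Set.mem_iUnion.mpr ⟨Y ω, le_refl (Y ω)⟩
    rw [huniv, measure_univ] at hlim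
    obtain ⟨r, hr, hr0⟩ := ((hlim.eventually_const_le hc).and (eventually_ge_atTop 0)).exists
    exact ⟨r, hr0, hr⟩
  have hright (n : ℕ) : c ≤ μ {ω | Y ω ≤ R + 1 / ((n : ℝ) + 1)} := by
    obtain ⟨r, hr, hlt⟩ := exists_lt_of_csInf_lt hne
      (hR.trans_lt (lt_add_of_pos_right R (Nat.one_div_pos_of_nat (α := ℝ) (n := n))))
    exact hr.2.trans (measure_mono fun ω hω ↦ le_trans hω hlt.le)
  have hlim : Tendsto (fun n : ℕ ↦ μ {ω | Y ω ≤ R + 1 / ((n : ℝ) + 1)}) atTop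
      (𝓝 (μ (⋂ n : ℕ, {ω | Y ω ≤ R + 1 / ((n : ℝ) + 1)}))) := by
    refine tendsto_measure_iInter_atTop
      (fun n ↦ (measurableSet_le hY measurable_const).nullMeasurableSet)
      (fun m n hmn ω (hω : Y ω ≤ _) ↦ hω.trans ?_) ⟨0, measure_ne_top _ _⟩
    gcongr
  have hinter : ⋂ n : ℕ, {ω | Y ω ≤ R + 1 / ((n : ℝ) + 1)} = {ω | Y ω ≤ R} := by
    ext ω
    simp only [Set.mem_iInter, Set.mem_ofPred_eq]
    refine ⟨fun h ↦ ?_, fun h n ↦ h.trans (le_add_of_nonneg_right (by positivity))⟩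
    have hR' := tendsto_one_div_add_atTop_nhds_zero_nat (𝕜 := ℝ).const_add R
    rw [add_zero] at hR'
    exact ge_of_tendsto' hR' h
  rw [hinter] at hlim
  exact ge_of_tendsto' hlim hright

open ProbabilityTheory in
/-- If every continuous linear functional is a centered Gaussian under the measure `ν` on a Banach
space, then `ν.prod ν` is invariant under rotation. -/
lemma map_rotation_prod_eq_self_of_centered {E : Type*} [NormedAddCommGroup E] [NormedSpace ℝ E]
    [CompleteSpace E] [SecondCountableTopology E] [MeasurableSpace E] [BorelSpace E]
    {ν : Measure E}
    (hν : ∀ φ : E →L[ℝ] ℝ, ∃ v : NNReal, ν.map φ = gaussianReal 0 v) (θ : ℝ) :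
    (ν.prod ν).map (ContinuousLinearMap.rotation θ) = ν.prod ν := by
  have : IsGaussian ν := isGaussian_of_map_eq_gaussianReal fun L ↦ ⟨0, hν L⟩
  refine IsGaussian.map_rotation_eq_self_of_forall_strongDual_eq_zero (fun L ↦ ?_) θ
  obtain ⟨v, hv⟩ := hν L
  calc ∫ x, L x ∂ν = ∫ y, y ∂(ν.map L) := by rw [integral_map (by fun_prop) (by fun_prop)]
    _ = 0 := by rw [hv, integral_id_gaussianReal]

open MeasureTheory

/-- Proposition 4.14 in the paper: Fernique's theorem with explicit constants. -/
theorem stmt_14 {V : Type*} [NormedAddCommGroup V] [NormedSpace ℝ V]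
    [TopologicalSpace.SeparableSpace V] [MeasurableSpace V] [BorelSpace V]
    {Ω : Type*} [MeasurableSpace Ω] (μ : Measure Ω) [IsProbabilityMeasure μ]
    (X : Ω → V) (hX : Measurable X)
    (hGauss : ∀ φ : V →L[ℝ] ℝ, ∃ v : NNReal,
      Measure.map (fun ω => φ (X ω)) μ = ProbabilityTheory.gaussianReal 0 v)
    (R : ℝ) (hR0 : 0 < R)
    (hR : sInf {r : ℝ | 0 ≤ r ∧ (9/10 : ENNReal) ≤ μ {ω | ‖X ω‖ ≤ r}} ≤ R) :
    (∫⁻ ω, ENNReal.ofReal (Real.exp (‖X ω‖ ^ 2 / (18 * R ^ 2))) ∂μ)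
        ≤ ENNReal.ofReal (Real.sqrt (Real.exp 1) + ∑' n : ℕ, (Real.exp 1 / 3) ^ (2 ^ n))
    ∧ Real.sqrt (Real.exp 1) + (∑' n : ℕ, (Real.exp 1 / 3) ^ (2 ^ n)) < 13 := by
  refine ⟨?_, sqrt_exp_one_add_tsum_lt⟩
  let E := UniformSpace.Completion V
  borelize E
  have : SecondCountableTopology E := UniformSpace.secondCountable_of_separable E
  let ι : V →L[ℝ] E := UniformSpace.Completion.toComplL
  have hι : Measurable ι := ι.continuous.measurable
  have hnorm (x : V) : ‖ι x‖ = ‖x‖ := UniformSpace.Completion.norm_coe x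
  have hY : Measurable fun ω ↦ ι (X ω) := hι.comp hX
  have hprob : IsProbabilityMeasure (μ.map fun ω ↦ ι (X ω)) :=
    Measure.isProbabilityMeasure_map hY.aemeasurable
  have hrot := map_rotation_prod_eq_self_of_centered (ν := μ.map fun ω ↦ ι (X ω)) (fun φ ↦ by
    obtain ⟨v, hv⟩ := hGauss (φ.comp ι)
    exact ⟨v, by rw [Measure.map_map (by fun_prop) hY, ← hv]; rfl⟩) (-(Real.pi / 4))
  have hc : (9 / 10 : ENNReal) < 1 := by
    rw [← ENNReal.toReal_lt_toReal (by finiteness) (by finiteness)]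
    norm_num
  have hball : (9 / 10 : ENNReal) ≤ (μ.map fun ω ↦ ι (X ω)) {x | ‖x‖ ≤ R} := by
    rw [Measure.map_apply hY (measurableSet_le measurable_norm measurable_const)]
    simpa only [Set.preimage_ofPred_eq, hnorm] using le_measure_le_of_sInf_le μ hX.norm hc hR
  have hbound := lintegral_exp_sq_norm_le_of_map_rotation_eq_self _ hrot hR0 hball
  rw [lintegral_map (by fun_prop) hY] at hbound
  simpa only [hnorm] using hbound
end
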